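/- arXiv:1703.03118 — 4 statements merged into one kernel-verified Lean document; each statement's English description precedes it below -/
import Mathlib

section
/- Let f ∈ A* be a linear functional on the Laurent polynomial algebra A = K[x,x⁻¹]. Then the span of the multiplication translates {f·g : g ∈ A} is finite-dimensional (i.e. f ∈ A°) if and only if there exist r ∈ ℕ and scalars c₁, …, c_r ∈ K such that f(xⁿ) = c₁ f(xⁿ⁻¹) + c₂ f(xⁿ⁻²) + ⋯ + c_r f(xⁿ⁻ʳ) for all n ∈ ℤ. -/
open LaurentPolynomial

namespace LaurentPolynomial

variable {K : Type*} [Field K]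

/-- The multiplication translate `f·g : a ↦ f (g * a)`, as a linear map in `g`. -/
noncomputable def translate (f : Module.Dual K K[T;T⁻¹]) :
    K[T;T⁻¹] →ₗ[K] Module.Dual K K[T;T⁻¹] :=
  (LinearMap.mul K K[T;T⁻¹]).compr₂ f

theorem translate_apply (f : Module.Dual K K[T;T⁻¹]) (g a : K[T;T⁻¹]) :
    translate f g a = f (g * a) := rfl

theorem range_translate (f : Module.Dual K K[T;T⁻¹]) :
    Submodule.span K (Set.range fun g : K[T;T⁻¹] => f ∘ₗ LinearMap.mulLeft K g) =
      LinearMap.range (translate f) := by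
  rw [← Submodule.span_eq (LinearMap.range (translate f))]
  rfl

/-- Two functionals agreeing on all powers of the variable are equal. -/
theorem dual_ext {f g : Module.Dual K K[T;T⁻¹]} (h : ∀ n : ℤ, f (T n) = g (T n)) : f = g := by
  ext n
  exact h n

/-- Translation by `x`, as an endomorphism of the dual space. -/
noncomputable def shift : Module.Dual K K[T;T⁻¹] →ₗ[K] Module.Dual K K[T;T⁻¹] :=
  (LinearMap.mulLeft K (T 1 : K[T;T⁻¹])).dualMap

theorem shift_apply (f : Module.Dual K K[T;T⁻¹]) (a : K[T;T⁻¹]) :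
    shift f a = f (T 1 * a) := rfl

theorem shift_injective : Function.Injective (shift (K := K)) := by
  intro f g h
  refine dual_ext fun n => ?_
  have := LinearMap.congr_fun h (T (n - 1))
  simpa only [shift_apply, ← T_add, add_sub_cancel] using this

theorem shift_translate_T (f : Module.Dual K K[T;T⁻¹]) (n : ℤ) :
    shift (translate f (T n)) = translate f (T (n + 1)) := by
  refine dual_ext fun m => ?_
  rw [shift_apply, translate_apply, translate_apply, T_add, mul_assoc]

/-- If the translates of `f` by powers of `x` start in a finite-dimensional shift-invariant
subspace, then all translates lie in it. -/
theorem range_translate_le {f : Module.Dual K K[T;T⁻¹]}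
    {W : Submodule K (Module.Dual K K[T;T⁻¹])} [FiniteDimensional K W]
    (hW : W.map shift ≤ W) (hf : translate f (T 0) ∈ W) :
    LinearMap.range (translate f) ≤ W := by
  have hmap : W.map shift = W :=
    Submodule.eq_of_le_of_finrank_eq hW
      (LinearEquiv.finrank_eq (Submodule.equivMapOfInjective shift shift_injective W)).symm
  have key : ∀ n : ℤ, translate f (T n) ∈ W := by
    intro n
    induction n using Int.induction_on with
    | zero => exact hf
    | succ n ih =>
      rw [← shift_translate_T]
      exact hW (Submodule.mem_map_of_mem ih)
    | pred n ih =>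
      rw [← hmap] at ih
      obtain ⟨w, hw, hwn⟩ := ih
      have : w = translate f (T (-n - 1)) :=
        shift_injective (by rw [hwn, shift_translate_T, sub_add_cancel])
      exact this ▸ hw
  rintro _ ⟨g, rfl⟩
  induction g using LaurentPolynomial.induction_on' with
  | add p q hp hq => rw [map_add]; exact W.add_mem hp hq
  | C_mul_T n a =>
    rw [← smul_eq_C_mul, map_smul]
    exact W.smul_mem a (key n)

theorem finiteDimensional_range_translate_of_recurrence {f : Module.Dual K K[T;T⁻¹]} {r : ℕ}
    {c : Fin r → K} (h : ∀ n : ℤ, f (T n) = ∑ j : Fin r, c j * f (T (n - (j.1 + 1)))) :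
    FiniteDimensional K (LinearMap.range (translate f)) := by
  let W := Submodule.span K (Set.range fun j : Fin r => translate f (T (-(j.1 + 1))))
  have : FiniteDimensional K W := FiniteDimensional.span_of_finite K (Set.finite_range _)
  have hf : translate f (T 0) ∈ W := by
    have : translate f (T 0) = ∑ j : Fin r, c j • translate f (T (-(j.1 + 1))) := by
      refine dual_ext fun n => ?_
      simp only [LinearMap.sum_apply, LinearMap.smul_apply, translate_apply, ← T_add,
        smul_eq_mul, zero_add, neg_add_eq_sub]
      exact h n
    rw [this]
    exact W.sum_mem fun j _ => W.smul_mem _ (Submodule.subset_span ⟨j, rfl⟩)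
  have hW : W.map shift ≤ W := by
    rw [Submodule.map_span_le]
    rintro _ ⟨⟨j, hj⟩, rfl⟩
    rw [shift_translate_T]
    cases j with
    | zero => simpa using hf
    | succ j =>
      refine Submodule.subset_span ⟨⟨j, by omega⟩, ?_⟩
      simp
  exact Submodule.finiteDimensional_of_le (range_translate_le hW hf)

theorem exists_monic_translate_eq_zero {f : Module.Dual K K[T;T⁻¹]}
    [FiniteDimensional K (LinearMap.range (translate f))] :
    ∃ p : Polynomial K, p.Monic ∧ translate f p.toLaurent = 0 := by
  let φ : Polynomial K →ₗ[K] LinearMap.range (translate f) :=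
    (translate f).rangeRestrict ∘ₗ Polynomial.toLaurentAlg.toLinearMap
  have : IsNoetherian K (LinearMap.range (translate f)) :=
    @isNoetherian_of_isNoetherianRing_of_finite K _ _ (Submodule.addCommGroup _) _ _ _
  have hφ : ¬ Function.Injective φ := fun hinj =>
    Polynomial.not_finite (R := K) (Module.Finite.of_injective φ hinj)
  rw [injective_iff_map_eq_zero] at hφ
  push Not at hφ
  obtain ⟨p, hp, hp0⟩ := hφ
  refine ⟨Polynomial.C p.leadingCoeff⁻¹ * p, ?_, ?_⟩
  · rw [mul_comm]
    exact Polynomial.monic_mul_leadingCoeff_inv hp0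
  · have hp' : translate f p.toLaurent = 0 := congrArg Subtype.val hp
    rw [map_mul, Polynomial.toLaurent_C, ← smul_eq_C_mul, map_smul, hp', smul_zero]

theorem exists_recurrence_of_finiteDimensional {f : Module.Dual K K[T;T⁻¹]}
    [FiniteDimensional K (LinearMap.range (translate f))] :
    ∃ (r : ℕ) (c : Fin r → K), ∀ n : ℤ,
      f (T n) = ∑ j : Fin r, c j * f (T (n - (j.1 + 1))) := by
  obtain ⟨p, hp, hpf⟩ := exists_monic_translate_eq_zero (f := f)
  refine ⟨p.natDegree, fun j => -p.coeff (p.natDegree - 1 - j), fun n => ?_⟩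
  have h := LinearMap.congr_fun hpf (T (n - p.natDegree))
  rw [translate_apply, congrArg Polynomial.toLaurent hp.as_sum] at h
  simp only [map_add, map_sum, map_mul, map_pow, Polynomial.toLaurent_X, Polynomial.toLaurent_C,
    T_pow, mul_one, add_mul, Finset.sum_mul, ← T_add, ← smul_eq_C_mul, smul_mul_assoc,
    map_smul, smul_eq_mul, LinearMap.zero_apply, add_sub_cancel] at h
  rw [eq_neg_of_add_eq_zero_left h, ← Finset.sum_range_reflect, ← Finset.sum_neg_distrib,
    Finset.sum_range]
  refine Finset.sum_congr rfl fun j _ => ?_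
  have hj : ((p.natDegree - 1 - j : ℕ) : ℤ) + (n - p.natDegree) = n - (j.1 + 1) := by
    have := j.2
    omega
  rw [hj, neg_mul]

end LaurentPolynomial

/-- a linear functional `f` on the Laurent polynomial algebra `A = K[x,x⁻¹]` has
finite-dimensional span of multiplication translates `f·g : a ↦ f (g * a)` (i.e. `f ∈ A°`)
if and only if the coefficient sequence `n ↦ f(xⁿ)` satisfies a linear recurrence
`f(xⁿ) = c₁ f(xⁿ⁻¹) + ⋯ + c_r f(xⁿ⁻ʳ)` for all `n ∈ ℤ`. -/
theorem statement0 (K : Type*) [Field K] [CharZero K]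
    (f : Module.Dual K (LaurentPolynomial K)) :
    FiniteDimensional K (Submodule.span K
      (Set.range fun g : LaurentPolynomial K => f ∘ₗ LinearMap.mulLeft K g)) ↔
    ∃ (r : ℕ) (c : Fin r → K), ∀ n : ℤ,
      f (T n) = ∑ j : Fin r, c j * f (T (n - (j.1 + 1))) := by
  rw [range_translate]
  exact ⟨fun _ => exists_recurrence_of_finiteDimensional,
    fun ⟨_, _, h⟩ => finiteDimensional_range_translate_of_recurrence h⟩
end

section
/- Let K be a field of characteristic different from 2, A a commutative associative unital K-algebra, ∂ a K-derivation of A, and L = A ⊕ A equipped with the componentwise multiplication μ and the bracket [(a,b),(c,d)] = (a∂(c) − ∂(a)c, a∂(d) − ∂(b)c). Suppose there exists h ∈ A such that the ideal of the associative algebra (L,μ) generated by the element (2∂(h), ∂(h)) has finite codimension in L (i.e. the quotient of L by this ideal is finite-dimensional over K). Then for every linear functional f ∈ L*, the span of the multiplication translates {v ↦ f(μ(w,v)) : w ∈ L} is finite-dimensional if and only if the span of the Lie translates {v ↦ f([w,v]) : w ∈ L} is finite-dimensional; that is, L°_μ = L°_φ. -/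
noncomputable section

variable (K A : Type*) [Field K] [CommRing A] [Algebra K A]

/-- The bracket `[(a,b),(c,d)] = (a∂(c) − ∂(a)c, a∂(d) − ∂(b)c)` on `L = A ⊕ A`,
for a `K`-derivation `∂` of `A`, as a bilinear map. -/
def dBracket (d : Derivation K A A) : (A × A) →ₗ[K] (A × A) →ₗ[K] (A × A) :=
  LinearMap.mk₂ K
    (fun u v => (u.1 * d v.1 - d u.1 * v.1, u.1 * d v.2 - d u.2 * v.1))
    (fun u u' v => by ext <;> simp [add_mul, mul_add, map_add] <;> ring_nf)
    (fun c u v => by ext <;> simp [map_smul, smul_mul_assoc, mul_smul_comm, smul_sub])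
    (fun u v v' => by ext <;> simp [add_mul, mul_add, map_add] <;> ring_nf)
    (fun c u v => by ext <;> simp [map_smul, smul_mul_assoc, mul_smul_comm, smul_sub])

section FiniteRank

variable {K V W V' W' : Type*} [Field K] [AddCommGroup V] [Module K V] [AddCommGroup W] [Module K W]
  [AddCommGroup V'] [Module K V'] [AddCommGroup W'] [Module K W']

theorem finiteDimensional_range_add {S T : V →ₗ[K] W}
    (hS : FiniteDimensional K (LinearMap.range S)) (hT : FiniteDimensional K (LinearMap.range T)) :
    FiniteDimensional K (LinearMap.range (S + T)) :=
  Submodule.finiteDimensional_of_le (LinearMap.range_add_le S T)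

theorem finiteDimensional_range_sub {S T : V →ₗ[K] W}
    (hS : FiniteDimensional K (LinearMap.range S)) (hT : FiniteDimensional K (LinearMap.range T)) :
    FiniteDimensional K (LinearMap.range (S - T)) := by
  rw [sub_eq_add_neg]
  exact finiteDimensional_range_add hS (by rwa [LinearMap.range_neg])

theorem finiteDimensional_range_comp_comp {T : V →ₗ[K] W}
    (hT : FiniteDimensional K (LinearMap.range T)) (g : W →ₗ[K] W') (e : V' →ₗ[K] V) :
    FiniteDimensional K (LinearMap.range (g ∘ₗ T ∘ₗ e)) := by
  rw [LinearMap.range_comp]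
  have : FiniteDimensional K (LinearMap.range (T ∘ₗ e)) :=
    Submodule.finiteDimensional_of_le (LinearMap.range_comp_le_range e T)
  infer_instance

/-- A linear map that has finite rank on a subspace of finite codimension has finite rank. -/
theorem finiteDimensional_range_of_map {T : V →ₗ[K] W} (N : Submodule K V)
    [FiniteDimensional K (V ⧸ N)] (hT : FiniteDimensional K (N.map T)) :
    FiniteDimensional K (LinearMap.range T) := by
  obtain ⟨N', hN⟩ := N.exists_isCompl
  have : FiniteDimensional K N' := (N.quotientEquivOfIsCompl N' hN).finiteDimensional
  rw [LinearMap.range_eq_map, ← hN.sup_eq_top, Submodule.map_sup]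
  infer_instance

/-- The translates of a functional `f` along a bilinear map `B` span the range of
`w ↦ f ∘ B w`. -/
theorem span_range_translates (B : V →ₗ[K] V →ₗ[K] V) (f : Module.Dual K V) :
    Submodule.span K (Set.range fun w => f ∘ₗ B w) = LinearMap.range (B.compr₂ f) :=
  Submodule.span_eq (LinearMap.range (B.compr₂ f))

end FiniteRank

section Translates

variable {K A : Type*} [Field K] [CommRing A] [Algebra K A]

theorem finiteDimensional_lie_translates (d : Derivation K A A) (f : Module.Dual K (A × A))
    (hf : FiniteDimensional K (LinearMap.range ((LinearMap.mul K (A × A)).compr₂ f))) :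
    FiniteDimensional K (LinearMap.range ((dBracket K A d).compr₂ f)) := by
  let D : (A × A) →ₗ[K] A × A := (d : A →ₗ[K] A).prodMap (d : A →ₗ[K] A)
  let δ : (A × A) →ₗ[K] A × A := (LinearMap.fst K A A).prod (LinearMap.fst K A A)
  have key : (dBracket K A d).compr₂ f =
      LinearMap.lcomp K K D ∘ₗ (LinearMap.mul K (A × A)).compr₂ f ∘ₗ δ -
      LinearMap.lcomp K K δ ∘ₗ (LinearMap.mul K (A × A)).compr₂ f ∘ₗ D := by
    refine LinearMap.ext fun w => LinearMap.ext fun v => ?_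
    change f _ = f _ - f _
    rw [← map_sub]
    rfl
  rw [key]
  exact finiteDimensional_range_sub (finiteDimensional_range_comp_comp hf _ _)
    (finiteDimensional_range_comp_comp hf _ _)

/-- The multiplication translate of `f` by `(2∂(h), ∂(h)) * w` is a combination of Lie translates
of `f` precomposed with fixed linear maps, because
`[(a,0),(hx,0)] - [(ha,0),(x,0)] = (2∂(h)ax, 0)` and
`[(b,0),(0,hy)] - [(hb,0),(0,y)] = (0, ∂(h)by)`. -/
theorem finiteDimensional_mul_translates_comp_mulLeft (d : Derivation K A A)
    (f : Module.Dual K (A × A)) (h : A)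
    (hf : FiniteDimensional K (LinearMap.range ((dBracket K A d).compr₂ f))) :
    FiniteDimensional K (LinearMap.range ((LinearMap.mul K (A × A)).compr₂ f ∘ₗ
      LinearMap.mulLeft K ((2 : A) * d h, d h))) := by
  let m : A →ₗ[K] A := LinearMap.mulLeft K h
  let i₁ : A →ₗ[K] A × A := LinearMap.inl K A A
  let i₂ : A →ₗ[K] A × A := LinearMap.inr K A A
  let p₁ : (A × A) →ₗ[K] A := LinearMap.fst K A A
  let p₂ : (A × A) →ₗ[K] A := LinearMap.snd K A A
  let T := (dBracket K A d).compr₂ f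
  have key : (LinearMap.mul K (A × A)).compr₂ f ∘ₗ LinearMap.mulLeft K ((2 : A) * d h, d h) =
      (LinearMap.lcomp K K (i₁ ∘ₗ m ∘ₗ p₁) ∘ₗ T ∘ₗ (i₁ ∘ₗ p₁) -
        LinearMap.lcomp K K (i₁ ∘ₗ p₁) ∘ₗ T ∘ₗ (i₁ ∘ₗ m ∘ₗ p₁)) +
      (LinearMap.lcomp K K (i₂ ∘ₗ m ∘ₗ p₂) ∘ₗ T ∘ₗ (i₁ ∘ₗ p₂) -
        LinearMap.lcomp K K (i₂ ∘ₗ p₂) ∘ₗ T ∘ₗ (i₁ ∘ₗ m ∘ₗ p₂)) := by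
    refine LinearMap.ext fun w => LinearMap.ext fun v => ?_
    change f _ = (f _ - f _) + (f _ - f _)
    rw [← map_sub, ← map_sub, ← map_add]
    congr 1
    ext <;> simp [dBracket, m, i₁, i₂, p₁, p₂] <;> ring
  rw [key]
  exact finiteDimensional_range_add
    (finiteDimensional_range_sub (finiteDimensional_range_comp_comp hf _ _)
      (finiteDimensional_range_comp_comp hf _ _))
    (finiteDimensional_range_sub (finiteDimensional_range_comp_comp hf _ _)
      (finiteDimensional_range_comp_comp hf _ _))

theorem restrictScalars_span_singleton_eq_range_mulLeft {R : Type*} [CommRing R] [Algebra K R]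
    (g : R) :
    (Ideal.span {g}).restrictScalars K = LinearMap.range (LinearMap.mulLeft K g) := by
  ext x
  simp [Ideal.mem_span_singleton, dvd_def, eq_comm]

end Translates

/-- let `K` be a field of characteristic `≠ 2`, `A` a commutative associative
unital `K`-algebra, `∂` a `K`-derivation of `A`, and `L = A ⊕ A` with componentwise
multiplication `μ` and the bracket `[(a,b),(c,d)] = (a∂(c) − ∂(a)c, a∂(d) − ∂(b)c)`.
If there is `h ∈ A` such that the ideal of `(L,μ)` generated by `(2∂(h), ∂(h))` has finite
codimension over `K`, then for every `f ∈ L*` the span of the multiplication translates of `f`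
is finite-dimensional iff the span of its Lie translates is; i.e. `L°_μ = L°_φ`. -/
theorem statement4 (h2 : (2 : K) ≠ 0) (d : Derivation K A A)
    (hh : ∃ h : A, FiniteDimensional K
      ((A × A) ⧸ Submodule.restrictScalars K
        (Ideal.span {((2 : A) * d h, d h)} : Ideal (A × A))))
    (f : Module.Dual K (A × A)) :
    FiniteDimensional K (Submodule.span K
      (Set.range fun w : A × A => f ∘ₗ LinearMap.mulLeft K w)) ↔
    FiniteDimensional K (Submodule.span K
      (Set.range fun w : A × A => f ∘ₗ dBracket K A d w)) := by
  obtain ⟨h, hh⟩ := hh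
  have hmul := span_range_translates (LinearMap.mul K (A × A)) f
  have hlie := span_range_translates (dBracket K A d) f
  change FiniteDimensional K (Submodule.span K
    (Set.range fun w : A × A => f ∘ₗ LinearMap.mul K (A × A) w)) ↔ _
  rw [hmul, hlie]
  refine ⟨finiteDimensional_lie_translates d f, fun hf => ?_⟩
  refine finiteDimensional_range_of_map
    ((Ideal.span {((2 : A) * d h, d h)}).restrictScalars K) ?_
  rw [restrictScalars_span_singleton_eq_range_mulLeft, ← LinearMap.range_comp]
  exact finiteDimensional_mul_translates_comp_mulLeft d f h hf

end
end

section
/- Fix m ∈ ℤ with m ≠ 0. Let V be the K-vector space with basis {e_i : i ∈ ℤ} ∪ {f_i : i ∈ ℤ}, and let [·,·] be the bilinear bracket on V determined by [e_i,e_j] = δ_{j,m+1}(1−i)e_i + δ_{i,1}(2m+1−j)e_{j−m} − δ_{i,m+1}(1−j)e_j − δ_{j,1}(2m+1−i)e_{i−m}, [e_i,f_j] = δ_{i,1}(m−j)f_{j−m} + δ_{i,m+1}·j·f_j, [f_j,e_i] = −[e_i,f_j], and [f_i,f_j] = 0 for all i, j ∈ ℤ. Then this bracket is alternating and satisfies the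 Jacobi identity, so it makes V an infinite-dimensional Lie algebra over K. -/
noncomputable section

variable (K : Type*) [Field K]

/-- The `K`-vector space with basis `{eᵢ : i ∈ ℤ} ∪ {fᵢ : i ∈ ℤ}`. -/
abbrev VV := (ℤ ⊕ ℤ) →₀ K

/-- The basis vector `eᵢ`. -/
def ee (i : ℤ) : VV K := Finsupp.single (Sum.inl i) 1

/-- The basis vector `fᵢ`. -/
def ff (i : ℤ) : VV K := Finsupp.single (Sum.inr i) 1

/-- The bilinear bracket on `V` determined by its values `B` on pairs of basis elements. -/
def vbr (B : ℤ ⊕ ℤ → ℤ ⊕ ℤ → VV K) : VV K →ₗ[K] VV K →ₗ[K] VV K :=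
  Finsupp.lsum K fun s => LinearMap.toSpanSingleton K (VV K →ₗ[K] VV K)
    (Finsupp.lsum K fun t => LinearMap.toSpanSingleton K (VV K) (B s t))

/-- The values on basis elements of the bracket of Statement 16 (arising from the r-matrix
`r = (x,0)⊗(x^{m+1},0) − (x^{m+1},0)⊗(x,0)`). -/
def B16 (m : ℤ) : ℤ ⊕ ℤ → ℤ ⊕ ℤ → VV K
  | Sum.inl i, Sum.inl j =>
      (if j = m + 1 then (1 : K) - (i : K) else 0) • ee K i
      + (if i = 1 then 2 * (m : K) + 1 - (j : K) else 0) • ee K (j - m)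
      - (if i = m + 1 then (1 : K) - (j : K) else 0) • ee K j
      - (if j = 1 then 2 * (m : K) + 1 - (i : K) else 0) • ee K (i - m)
  | Sum.inl i, Sum.inr j =>
      (if i = 1 then (m : K) - (j : K) else 0) • ff K (j - m)
      + (if i = m + 1 then (j : K) else 0) • ff K j
  | Sum.inr j, Sum.inl i =>
      -((if i = 1 then (m : K) - (j : K) else 0) • ff K (j - m)
        + (if i = m + 1 then (j : K) else 0) • ff K j)
  | Sum.inr _, Sum.inr _ => 0

/-- The operator `eⱼ ↦ (2m+1−j)e_{j−m}`, `fⱼ ↦ (m−j)f_{j−m}`. -/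
def lowering (m : ℤ) : VV K →ₗ[K] VV K :=
  Finsupp.linearCombination K (Sum.elim
    (fun j : ℤ => (2 * (m : K) + 1 - (j : K)) • ee K (j - m))
    (fun j : ℤ => ((m : K) - (j : K)) • ff K (j - m)))

/-- The diagonal operator `eⱼ ↦ (j−1)eⱼ`, `fⱼ ↦ jfⱼ`. -/
def grading : VV K →ₗ[K] VV K :=
  Finsupp.linearCombination K (Sum.elim
    (fun j : ℤ => ((j : K) - 1) • ee K j)
    (fun j : ℤ => (j : K) • ff K j))

variable {K}

theorem vbr_single_single (B : ℤ ⊕ ℤ → ℤ ⊕ ℤ → VV K) (s t : ℤ ⊕ ℤ) :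
    vbr K B (Finsupp.single s 1) (Finsupp.single t 1) = B s t := by
  simp [vbr]

theorem lowering_apply_inl (m j : ℤ) (u : VV K) :
    lowering K m u (Sum.inl j) = ((m : K) + 1 - j) * u (Sum.inl (m + j)) := by
  induction u using Finsupp.induction_linear with
  | zero => simp
  | add u v hu hv => simp [hu, hv, mul_add]
  | single s c =>
    rcases s with i | i
    · by_cases h : i = m + j
      · subst h
        simp [lowering, ee]
        ring
      · have h' : i - m ≠ j := by omega
        simp [lowering, ee, h, h']
    · simp [lowering, ff]

theorem grading_apply_inl (j : ℤ) (u : VV K) :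
    grading K u (Sum.inl j) = ((j : K) - 1) * u (Sum.inl j) := by
  induction u using Finsupp.induction_linear with
  | zero => simp
  | add u v hu hv => simp [hu, hv, mul_add]
  | single s c =>
    rcases s with i | i
    · by_cases h : i = j
      · subst h
        simp [grading, ee]
        ring
      · simp [grading, ee, h]
    · simp [grading, ff]

/-- The commutation relation `[D, H] = mD` between the lowering and the grading operator. -/
theorem lowering_grading (m : ℤ) (u : VV K) :
    lowering K m (grading K u) = grading K (lowering K m u) + (m : K) • lowering K m u := by
  induction u using Finsupp.induction_linear with
  | zero => simp
  | add u v hu hv => simp only [map_add, hu, hv, smul_add]; abel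
  | single s c =>
    rcases s with i | i
    · simp only [lowering, grading, ee, Finsupp.linearCombination_single, Sum.elim_inl, map_smul,
        one_smul, Int.cast_sub]
      module
    · simp only [lowering, grading, ff, Finsupp.linearCombination_single, Sum.elim_inr, map_smul,
        one_smul, Int.cast_sub]
      module

/-- The bracket in terms of the coordinates along `e₁`, `e_{m+1}` and the two operators. -/
theorem vbr_B16_apply (m : ℤ) (u v : VV K) :
    vbr K (B16 K m) u v =
      u (Sum.inl 1) • lowering K m v - v (Sum.inl 1) • lowering K m u
        + u (Sum.inl (m + 1)) • grading K v - v (Sum.inl (m + 1)) • grading K u := by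
  induction u using Finsupp.induction_linear with
  | zero => simp
  | add u u' hu hu' =>
    simp only [map_add, LinearMap.add_apply, hu, hu', Finsupp.add_apply]
    module
  | single s c =>
    induction v using Finsupp.induction_linear with
    | zero => simp
    | add v v' hv hv' =>
      simp only [map_add, hv, hv', Finsupp.add_apply]
      module
    | single t d =>
      rw [← mul_one c, ← mul_one d, ← smul_eq_mul, ← smul_eq_mul, ← Finsupp.smul_single,
        ← Finsupp.smul_single, map_smul, map_smul, LinearMap.smul_apply, vbr_single_single]
      rcases s with i | i <;> rcases t with j | j <;>
        simp only [B16, lowering, grading, map_smul, Finsupp.smul_apply,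
          Finsupp.linearCombination_single, Sum.elim_inl, Sum.elim_inr, Finsupp.single_apply,
          Sum.inl.injEq, reduceCtorEq, if_false, smul_eq_mul] <;>
        (try split_ifs) <;> module

variable (K)

/-- for `m ≠ 0`, the bilinear bracket on the space `V` with basis
`{eᵢ} ∪ {fᵢ}` given by `[eᵢ,eⱼ] = δ_{j,m+1}(1−i)eᵢ + δ_{i,1}(2m+1−j)e_{j−m} −
δ_{i,m+1}(1−j)eⱼ − δ_{j,1}(2m+1−i)e_{i−m}`, `[eᵢ,fⱼ] = δ_{i,1}(m−j)f_{j−m} + δ_{i,m+1}·j·fⱼ`,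
`[fⱼ,eᵢ] = −[eᵢ,fⱼ]`, `[fᵢ,fⱼ] = 0` is alternating and satisfies the Jacobi identity, so it
makes `V` an infinite-dimensional Lie algebra. -/
theorem statement16 [CharZero K] (m : ℤ) (hm : m ≠ 0) :
    (∀ u : VV K, vbr K (B16 K m) u u = 0) ∧
    (∀ u v w : VV K,
      vbr K (B16 K m) (vbr K (B16 K m) u v) w
        + vbr K (B16 K m) (vbr K (B16 K m) v w) u
        + vbr K (B16 K m) (vbr K (B16 K m) w u) v = 0) ∧
    ¬ FiniteDimensional K (VV K) := by
  refine ⟨fun u => ?_, fun u v w => ?_, fun h => ?_⟩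
  · rw [vbr_B16_apply]
    module
  · simp only [vbr_B16_apply]
    simp only [Finsupp.sub_apply, Finsupp.add_apply, Finsupp.smul_apply, map_sub,
      map_add, map_smul, lowering_apply_inl, grading_apply_inl, lowering_grading, smul_eq_mul, Int.cast_add,
      Int.cast_one]
    module
  · have := Module.Finite.finite_basis (Finsupp.basisSingleOne (R := K) (ι := ℤ ⊕ ℤ))
    exact not_finite (ℤ ⊕ ℤ)

end
end

section
/- Fix m ∈ ℤ and q ∈ K. Let V be the K-vector space with basis {e_i : i ∈ ℤ} ∪ {f_i : i ∈ ℤ}, and let [·,·] be the bilinear bracket on V determined by [e_i,e_j] = 0, [e_i,f_j] = δ_{j,m}(1−i)q·e_i + δ_{i,1}·mq·e_{j−m+1}, [f_j,e_i] = −[e_i,f_j], and [f_i,f_j] = δ_{i,m}·jq·f_j − δ_{j,m}·iq·f_i for all i, j ∈ ℤ. Then this bracket is alternating and satisfies the Jacobi identity, so it makes V an infinite-dimensional Lie algebra over K. -/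
noncomputable section

variable (K : Type*) [Field K]

/-- The values on basis elements of the bracket of Statement 18 (arising from the r-matrices
`r = (x,0)⊗(x,qxᵐ) − (x,qxᵐ)⊗(x,0)` or `r′ = (x,0)⊗(0,qxᵐ) − (0,qxᵐ)⊗(x,0)`). -/
def B18 (m : ℤ) (q : K) : ℤ ⊕ ℤ → ℤ ⊕ ℤ → VV K
  | Sum.inl _, Sum.inl _ => 0
  | Sum.inl i, Sum.inr j =>
      (if j = m then ((1 : K) - (i : K)) * q else 0) • ee K i
      + (if i = 1 then (m : K) * q else 0) • ee K (j - m + 1)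
  | Sum.inr j, Sum.inl i =>
      -((if j = m then ((1 : K) - (i : K)) * q else 0) • ee K i
        + (if i = 1 then (m : K) * q else 0) • ee K (j - m + 1))
  | Sum.inr i, Sum.inr j =>
      (if i = m then (j : K) * q else 0) • ff K j
      - (if j = m then (i : K) * q else 0) • ff K i

theorem vbr_single (B : ℤ ⊕ ℤ → ℤ ⊕ ℤ → VV K) (s t : ℤ ⊕ ℤ) (a b : K) :
    vbr K B (Finsupp.single s a) (Finsupp.single t b) = (a * b) • B s t := by
  simp [vbr, mul_smul]

/-- A bracket is skew-symmetric as soon as it is so on basis elements. -/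
theorem vbr_skew {B : ℤ ⊕ ℤ → ℤ ⊕ ℤ → VV K} (hB : ∀ s t, B s t = -B t s) (u v : VV K) :
    vbr K B u v = -vbr K B v u := by
  induction u using Finsupp.induction_linear with
  | zero => simp
  | add x y hx hy => simp only [map_add, LinearMap.add_apply, hx, hy, neg_add]
  | single s a =>
    induction v using Finsupp.induction_linear with
    | zero => simp
    | add x y hx hy => simp only [map_add, LinearMap.add_apply, hx, hy, neg_add]
    | single t b => rw [vbr_single, vbr_single, hB s t, smul_neg, mul_comm]

/-- The Jacobi identity holds as soon as it holds on basis elements. -/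
theorem vbr_jacobi {B : ℤ ⊕ ℤ → ℤ ⊕ ℤ → VV K}
    (hB : ∀ r s t, vbr K B (B r s) (Finsupp.single t 1) + vbr K B (B s t) (Finsupp.single r 1)
      + vbr K B (B t r) (Finsupp.single s 1) = 0) (u v w : VV K) :
    vbr K B (vbr K B u v) w + vbr K B (vbr K B v w) u + vbr K B (vbr K B w u) v = 0 := by
  induction u using Finsupp.induction_linear with
  | zero => simp
  | add x y hx hy =>
    simp only [map_add, LinearMap.add_apply]
    linear_combination (norm := module) hx + hy
  | single r a =>
    induction v using Finsupp.induction_linear with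
    | zero => simp
    | add x y hx hy =>
      simp only [map_add, LinearMap.add_apply]
      linear_combination (norm := module) hx + hy
    | single s b =>
      induction w using Finsupp.induction_linear with
      | zero => simp
      | add x y hx hy =>
        simp only [map_add, LinearMap.add_apply]
        linear_combination (norm := module) hx + hy
      | single t c =>
        have h1 : ∀ (p : ℤ ⊕ ℤ) (d : K),
            Finsupp.single p d = d • (Finsupp.single p 1 : VV K) := by simp
        simp only [vbr_single, map_smul, LinearMap.smul_apply]
        rw [h1 t c, h1 r a, h1 s b]
        simp only [map_smul]
        linear_combination (norm := module) (a * b * c) • hB r s t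

theorem B18_skew (m : ℤ) (q : K) (s t : ℤ ⊕ ℤ) : B18 K m q s t = -B18 K m q t s := by
  rcases s with i | i <;> rcases t with j | j <;> simp [B18]

theorem B18_jacobi_inl_inr_inr (m : ℤ) (q : K) (i j k : ℤ) :
    vbr K (B18 K m q) (B18 K m q (.inl i) (.inr j)) (Finsupp.single (.inr k) 1)
      + vbr K (B18 K m q) (B18 K m q (.inr j) (.inr k)) (Finsupp.single (.inl i) 1)
      + vbr K (B18 K m q) (B18 K m q (.inr k) (.inl i)) (Finsupp.single (.inr j) 1) = 0 := by
  simp only [B18, ee, ff, map_add, map_sub, map_neg, map_smul, LinearMap.add_apply,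
    LinearMap.sub_apply, LinearMap.neg_apply, LinearMap.smul_apply, vbr_single, mul_one, one_smul]
  by_cases hj : j = m <;> by_cases hk : k = m <;> by_cases hi : i = 1 <;>
    simp [hi, hj, hk, sub_eq_zero, -Finsupp.smul_single] <;> module

theorem B18_jacobi_inr_inr_inr (m : ℤ) (q : K) (i j k : ℤ) :
    vbr K (B18 K m q) (B18 K m q (.inr i) (.inr j)) (Finsupp.single (.inr k) 1)
      + vbr K (B18 K m q) (B18 K m q (.inr j) (.inr k)) (Finsupp.single (.inr i) 1)
      + vbr K (B18 K m q) (B18 K m q (.inr k) (.inr i)) (Finsupp.single (.inr j) 1) = 0 := by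
  simp only [B18, ff, map_sub, map_smul, LinearMap.sub_apply, LinearMap.smul_apply, vbr_single,
    mul_one, one_smul]
  by_cases hi : i = m <;> by_cases hj : j = m <;> by_cases hk : k = m <;>
    simp [hi, hj, hk, -Finsupp.smul_single]

theorem B18_jacobi_inl_inl (m : ℤ) (q : K) (i j : ℤ) (t : ℤ ⊕ ℤ) :
    vbr K (B18 K m q) (B18 K m q (.inl i) (.inl j)) (Finsupp.single t 1)
      + vbr K (B18 K m q) (B18 K m q (.inl j) t) (Finsupp.single (.inl i) 1)
      + vbr K (B18 K m q) (B18 K m q t (.inl i)) (Finsupp.single (.inl j) 1) = 0 := by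
  rcases t with k | k <;> simp [B18, ee, vbr_single, -Finsupp.smul_single, -ite_smul]

theorem B18_jacobi (m : ℤ) (q : K) (r s t : ℤ ⊕ ℤ) :
    vbr K (B18 K m q) (B18 K m q r s) (Finsupp.single t 1)
      + vbr K (B18 K m q) (B18 K m q s t) (Finsupp.single r 1)
      + vbr K (B18 K m q) (B18 K m q t r) (Finsupp.single s 1) = 0 := by
  rcases r with i | i <;> rcases s with j | j <;> rcases t with k | k
  · exact B18_jacobi_inl_inl K m q i j (.inl k)
  · exact B18_jacobi_inl_inl K m q i j (.inr k)
  · rw [← B18_jacobi_inl_inl K m q k i (.inr j)]; abel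
  · exact B18_jacobi_inl_inr_inr K m q i j k
  · rw [← B18_jacobi_inl_inl K m q j k (.inr i)]; abel
  · rw [← B18_jacobi_inl_inr_inr K m q j k i]; abel
  · rw [← B18_jacobi_inl_inr_inr K m q k i j]; abel
  · exact B18_jacobi_inr_inr_inr K m q i j k

/-- the bilinear bracket on the space `V` with basis `{eᵢ} ∪ {fᵢ}` given by
`[eᵢ,eⱼ] = 0`, `[eᵢ,fⱼ] = δ_{j,m}(1−i)q·eᵢ + δ_{i,1}·mq·e_{j−m+1}`, `[fⱼ,eᵢ] = −[eᵢ,fⱼ]`,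
`[fᵢ,fⱼ] = δ_{i,m}·jq·fⱼ − δ_{j,m}·iq·fᵢ` is alternating and satisfies the Jacobi identity,
so it makes `V` an infinite-dimensional Lie algebra. -/
theorem statement18 [CharZero K] (m : ℤ) (q : K) :
    (∀ u : VV K, vbr K (B18 K m q) u u = 0) ∧
    (∀ u v w : VV K,
      vbr K (B18 K m q) (vbr K (B18 K m q) u v) w
        + vbr K (B18 K m q) (vbr K (B18 K m q) v w) u
        + vbr K (B18 K m q) (vbr K (B18 K m q) w u) v = 0) ∧
    ¬ FiniteDimensional K (VV K) := by
  have hskew := vbr_skew K (B18_skew K m q)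
  refine ⟨fun u => self_eq_neg.mp (hskew u u), vbr_jacobi K (B18_jacobi K m q), fun h => ?_⟩
  exact not_finite_iff_infinite.mpr inferInstance (Module.Finite.finite_basis
    (Finsupp.basisSingleOne : Module.Basis (ℤ ⊕ ℤ) K (VV K)))

end
end
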